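/- Let A be an order-k real tensor with all mode dimensions equal to d (d ≥ 1), and let π = {B₁,…,B_ℓ} be a partition of [k] into ℓ blocks. Then d^{−(k − max_{i∈[ℓ]}|B_i|)/2} · ‖A‖_F ≤ ‖Unfold_π(A)‖_σ ≤ ‖A‖_F, where |B_i| denotes the number of elements of block B_i. -/

import Mathlib

open scoped BigOperators ENNReal

namespace TensorUnfolding

/-- The vector `l^p` norm of a finitely-indexed real vector, for `p ∈ [1, ∞]`
(for `p = ∞` it is the maximum of the absolute values of the entries). -/
noncomputable def pNorm (p : ℝ≥0∞) {ι : Type} [Fintype ι] (x : ι → ℝ) : ℝ :=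
  if p = ⊤ then ⨆ i, |x i| else (∑ i, |x i| ^ p.toReal) ^ (1 / p.toReal)

/-- `π` is a partition of `[k] = {0, …, k-1}`: a collection of disjoint nonempty
blocks whose union is all of `Fin k`. -/
def IsPartition {k : ℕ} (π : Finset (Finset (Fin k))) : Prop :=
  (∀ B ∈ π, B.Nonempty) ∧
  (∀ B ∈ π, ∀ B' ∈ π, B ≠ B' → Disjoint B B') ∧
  π.sup id = Finset.univ

/-- `π₁ ≤ π₂`: every block of `π₁` is contained in some block of `π₂`. -/
def Refines {k : ℕ} (π₁ π₂ : Finset (Finset (Fin k))) : Prop :=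
  ∀ B ∈ π₁, ∃ B' ∈ π₂, B ⊆ B'

/-- The finest partition `0_{[k]} = {{1}, …, {k}}`. -/
def botPartition (k : ℕ) : Finset (Finset (Fin k)) :=
  Finset.univ.image fun n => {n}

/-- The coarsest (one-block) partition `1_{[k]} = {[k]}`. -/
def topPartition (k : ℕ) : Finset (Finset (Fin k)) :=
  {Finset.univ}

/-- The meet `π₁ ∧ π₂`: the partition whose blocks are the nonempty
intersections `B ∩ B'` with `B ∈ π₁`, `B' ∈ π₂`. -/
def meetPartition {k : ℕ} (π₁ π₂ : Finset (Finset (Fin k))) : Finset (Finset (Fin k)) :=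
  ((π₁ ×ˢ π₂).image fun p => p.1 ∩ p.2).filter fun B => B.Nonempty

/-- The `l^p` operator norm of the unfolding of the tensor `A` induced by the
partition `π`: the supremum of `⟨A, ⊗_{B ∈ π} y_B⟩` over choices, for each block
`B ∈ π`, of a vector `y_B` indexed by `Π_{j ∈ B} Fin (d j)` with `l^p` norm 1. -/
noncomputable def unfoldNormP {k : ℕ} (p : ℝ≥0∞) (d : Fin k → ℕ)
    (A : ((n : Fin k) → Fin (d n)) → ℝ) (π : Finset (Finset (Fin k))) : ℝ :=
  sSup { r : ℝ |
    ∃ y : (B : Finset (Fin k)) → ((j : B) → Fin (d j.1)) → ℝ,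
      (∀ B ∈ π, pNorm p (y B) = 1) ∧
      r = ∑ i : (n : Fin k) → Fin (d n), A i * ∏ B ∈ π, y B fun j => i j.1 }

/-- The spectral norm of the unfolding of the tensor `A` induced by the
partition `π`: the supremum of `⟨A, ⊗_{B ∈ π} y_B⟩` over choices, for each block
`B ∈ π`, of a vector `y_B` indexed by `Π_{j ∈ B} Fin (d j)` with Euclidean norm 1. -/
noncomputable def unfoldNorm {k : ℕ} (d : Fin k → ℕ)
    (A : ((n : Fin k) → Fin (d n)) → ℝ) (π : Finset (Finset (Fin k))) : ℝ :=
  sSup { r : ℝ |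
    ∃ y : (B : Finset (Fin k)) → ((j : B) → Fin (d j.1)) → ℝ,
      (∀ B ∈ π, ∑ v, (y B v) ^ 2 = 1) ∧
      r = ∑ i : (n : Fin k) → Fin (d n), A i * ∏ B ∈ π, y B fun j => i j.1 }

/-- The `l^p` operator norm of the tensor `A`:
`‖A‖_p = sup { A(x₁, …, x_k) : ‖x_n‖_p = 1 }`. -/
noncomputable def opNormP {k : ℕ} (p : ℝ≥0∞) (d : Fin k → ℕ)
    (A : ((n : Fin k) → Fin (d n)) → ℝ) : ℝ :=
  sSup { r : ℝ | ∃ x : (n : Fin k) → Fin (d n) → ℝ,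
    (∀ n, pNorm p (x n) = 1) ∧
    r = ∑ i : (n : Fin k) → Fin (d n), A i * ∏ n, x n (i n) }

/-- The spectral norm of the tensor `A`:
`‖A‖_σ = sup { A(x₁, …, x_k) : ‖x_n‖₂ = 1 }`. -/
noncomputable def specNorm {k : ℕ} (d : Fin k → ℕ)
    (A : ((n : Fin k) → Fin (d n)) → ℝ) : ℝ :=
  sSup { r : ℝ | ∃ x : (n : Fin k) → Fin (d n) → ℝ,
    (∀ n, ∑ i, (x n i) ^ 2 = 1) ∧
    r = ∑ i : (n : Fin k) → Fin (d n), A i * ∏ n, x n (i n) }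

/-- The Frobenius norm of the tensor `A`. -/
noncomputable def frobNorm {k : ℕ} (d : Fin k → ℕ)
    (A : ((n : Fin k) → Fin (d n)) → ℝ) : ℝ :=
  Real.sqrt (∑ i : (n : Fin k) → Fin (d n), (A i) ^ 2)

/-- `D_A(B, B') = Π_{n ∈ B ∩ B'} d_n` if `B ∩ B' ≠ ∅`, and `0` otherwise. -/
def blockDim {k : ℕ} (d : Fin k → ℕ) (B B' : Finset (Fin k)) : ℕ :=
  if (B ∩ B').Nonempty then ∏ n ∈ B ∩ B', d n else 0

/-- `dim_A(π₁, π₂) = Π_{B ∈ π₁} max_{B' ∈ π₂} D_A(B, B')`. -/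
def dimRel {k : ℕ} (d : Fin k → ℕ) (π₁ π₂ : Finset (Finset (Fin k))) : ℕ :=
  ∏ B ∈ π₁, π₂.sup fun B' => blockDim d B B'

/-- `A` is `π`-orthogonal decomposable: `A = Σ_{n=1}^r λ_n a₁⁽ⁿ⁾ ⊗ ⋯ ⊗ a_k⁽ⁿ⁾`
with `λ₁ ≥ ⋯ ≥ λ_r ≥ 0` and `Π_{i ∈ B} ⟨a_i⁽ⁿ⁾, a_i⁽ᵐ⁾⟩ = δ_{nm}` for every
block `B ∈ π`. -/
def IsPiOD {k : ℕ} (d : Fin k → ℕ) (A : ((n : Fin k) → Fin (d n)) → ℝ)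
    (π : Finset (Finset (Fin k))) : Prop :=
  ∃ (r : ℕ) (lam : Fin r → ℝ) (a : Fin r → (n : Fin k) → Fin (d n) → ℝ),
    Antitone lam ∧ (∀ n, 0 ≤ lam n) ∧
    (∀ i, A i = ∑ n, lam n * ∏ m, a n m (i m)) ∧
    (∀ B ∈ π, ∀ n m : Fin r,
      (∏ j ∈ B, ∑ t, a n j t * a m j t) = if n = m then 1 else 0)

end TensorUnfolding
namespace TensorUnfolding

/-- A finite real vector is normed by some unit vector. -/
theorem exists_unit_sum_mul_eq_sqrt {ι : Type*} [Fintype ι] [DecidableEq ι] [Nonempty ι]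
    (a : ι → ℝ) :
    ∃ u : ι → ℝ, ∑ v, u v ^ 2 = 1 ∧ ∑ v, a v * u v = √(∑ v, a v ^ 2) := by
  have hnn : 0 ≤ ∑ v, a v ^ 2 := Finset.sum_nonneg fun v _ => sq_nonneg _
  by_cases h : ∑ v, a v ^ 2 = 0
  · have ha : ∀ v, a v = 0 := fun v =>
      pow_eq_zero_iff two_ne_zero |>.1
        ((Finset.sum_eq_zero_iff_of_nonneg fun v _ => sq_nonneg (a v)).1 h v (Finset.mem_univ v))
    refine ⟨Pi.single (Classical.arbitrary ι) 1, ?_, ?_⟩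
    · simp [Pi.single_apply]
    · simp [ha]
  · refine ⟨fun v => a v / √(∑ v, a v ^ 2), ?_, ?_⟩
    · simp_rw [div_pow, Real.sq_sqrt hnn]
      rw [← Finset.sum_div, div_self h]
    · simp_rw [← mul_div_assoc, ← pow_two]
      rw [← Finset.sum_div, Real.div_sqrt]

theorem IsPartition.exists_mem {k : ℕ} {π : Finset (Finset (Fin k))} (hπ : IsPartition π)
    (n : Fin k) : ∃ B ∈ π, n ∈ B := by
  have h : n ∈ π.sup id := hπ.2.2 ▸ Finset.mem_univ n
  simpa [Finset.mem_sup] using h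

/-- The elementary tensor `⊗_{B ∈ π} y_B` of unit vectors has Frobenius norm at most one. -/
theorem sum_prod_sq_le_one {k d : ℕ} {π : Finset (Finset (Fin k))} (hπ : IsPartition π)
    (y : (B : Finset (Fin k)) → (B → Fin d) → ℝ) (hy : ∀ B ∈ π, ∑ v, y B v ^ 2 = 1) :
    ∑ i : Fin k → Fin d, (∏ B ∈ π, y B fun j => i j.1) ^ 2 ≤ 1 := by
  classical
  let r : (Fin k → Fin d) → (B : π) → (B.1 → Fin d) := fun i _ j => i j.1
  have hr : Function.Injective r := fun i i' h => funext fun n => by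
    obtain ⟨B, hB, hn⟩ := hπ.exists_mem n
    exact congrFun (congrFun h ⟨B, hB⟩) ⟨n, hn⟩
  calc ∑ i : Fin k → Fin d, (∏ B ∈ π, y B fun j => i j.1) ^ 2
      = ∑ i : Fin k → Fin d, ∏ B : π, y B.1 (r i B) ^ 2 := by
        refine Finset.sum_congr rfl fun i _ => ?_
        rw [← Finset.prod_pow, ← Finset.prod_coe_sort]
    _ = ∑ p ∈ Finset.univ.image r, ∏ B : π, y B.1 (p B) ^ 2 :=
        (Finset.sum_image (f := fun p : (B : π) → (B.1 → Fin d) => ∏ B : π, y B.1 (p B) ^ 2)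
          fun _ _ _ _ h => hr h).symm
    _ ≤ ∑ p : (B : π) → (B.1 → Fin d), ∏ B : π, y B.1 (p B) ^ 2 :=
        Finset.sum_le_sum_of_subset_of_nonneg (Finset.subset_univ _) fun _ _ _ =>
          Finset.prod_nonneg fun _ _ => sq_nonneg _
    _ = ∏ B : π, ∑ v, y B.1 v ^ 2 := (Fintype.prod_sum fun (B : π) v => y B.1 v ^ 2).symm
    _ = 1 := Finset.prod_eq_one fun B _ => hy B.1 B.2

theorem sum_mul_prod_le_frobNorm {k d : ℕ} {π : Finset (Finset (Fin k))} (hπ : IsPartition π)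
    (A : (Fin k → Fin d) → ℝ)
    (y : (B : Finset (Fin k)) → (B → Fin d) → ℝ) (hy : ∀ B ∈ π, ∑ v, y B v ^ 2 = 1) :
    ∑ i : Fin k → Fin d, A i * ∏ B ∈ π, y B (fun j => i j.1) ≤ frobNorm (fun _ => d) A := by
  refine (Real.sum_mul_le_sqrt_mul_sqrt _ _ _).trans ?_
  exact mul_le_of_le_one_right (Real.sqrt_nonneg _)
    (Real.sqrt_le_one.2 (sum_prod_sq_le_one hπ y hy))

/-- Freezing the indices outside a block `C ∈ π` gives a vector whose Euclidean norm is attained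
by a choice of unit vectors. -/
theorem exists_unit_eq_sqrt_slice {k d : ℕ} (hd : 1 ≤ d) {π : Finset (Finset (Fin k))}
    (hπ : IsPartition π) (A : (Fin k → Fin d) → ℝ) {C : Finset (Fin k)} (hC : C ∈ π)
    (w : {n // n ∉ C} → Fin d) :
    ∃ y : (B : Finset (Fin k)) → (B → Fin d) → ℝ, (∀ B ∈ π, ∑ v, y B v ^ 2 = 1) ∧
      √(∑ v, A ((Equiv.piEquivPiSubtypeProd (· ∈ C) fun _ => Fin d).symm (v, w)) ^ 2) =
        ∑ i : Fin k → Fin d, A i * ∏ B ∈ π, y B fun j => i j.1 := by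
  classical
  have : NeZero d := ⟨by omega⟩
  let e := Equiv.piEquivPiSubtypeProd (· ∈ C) fun _ => Fin d
  obtain ⟨u, hu, hAu⟩ := exists_unit_sum_mul_eq_sqrt
    fun v : {n // n ∈ C} → Fin d => A (e.symm (v, w))
  let i₀ : Fin k → Fin d := e.symm (0, w)
  let y : (B : Finset (Fin k)) → (B → Fin d) → ℝ :=
    Function.update (fun B v => if v = fun j => i₀ j.1 then 1 else 0) C u
  have hyC : y C = u := Function.update_self ..
  have hyB : ∀ B, B ≠ C → y B = fun v => if v = fun j => i₀ j.1 then 1 else 0 :=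
    fun B hB => Function.update_of_ne hB ..
  have hin : ∀ v w', (fun j : C => e.symm (v, w') j.1) = v := fun v w' => by
    funext j
    simp [e, Equiv.piEquivPiSubtypeProd]
  have hout : ∀ v w' n (hn : n ∉ C), e.symm (v, w') n = w' ⟨n, hn⟩ := fun v w' n hn => by
    simp [e, Equiv.piEquivPiSubtypeProd, hn]
  refine ⟨y, fun B hB => ?_, ?_⟩
  · by_cases h : B = C
    · subst h
      rw [hyC, ← hu]
    · simp [hyB B h]
  · have hprod : ∀ v w', ∏ B ∈ π.erase C, y B (fun j => e.symm (v, w') j.1) =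
        if w' = w then 1 else 0 := by
      intro v w'
      split_ifs with h
      · subst h
        refine Finset.prod_eq_one fun B hB => ?_
        obtain ⟨hne, hB⟩ := Finset.mem_erase.1 hB
        rw [hyB B hne]
        refine if_pos (funext fun j => ?_)
        have hj : j.1 ∉ C := Finset.disjoint_left.1 (hπ.2.1 B hB C hC hne) j.2
        exact (hout _ _ _ hj).trans (hout _ _ _ hj).symm
      · obtain ⟨n, hn⟩ := Function.ne_iff.1 h
        obtain ⟨B, hB, hnB⟩ := hπ.exists_mem n.1
        have hne : B ≠ C := fun hBC => n.2 (hBC ▸ hnB)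
        refine Finset.prod_eq_zero (Finset.mem_erase.2 ⟨hne, hB⟩) ?_
        rw [hyB B hne]
        refine if_neg fun hv => hn ?_
        have := congrFun hv ⟨n.1, hnB⟩
        simpa only [i₀, hout _ _ _ n.2] using this
    rw [← hAu, ← Equiv.sum_comp e.symm, Fintype.sum_prod_type]
    refine Finset.sum_congr rfl fun v _ => ?_
    simp_rw [← Finset.mul_prod_erase π _ hC, hprod, hyC, hin]
    simp

/-- Some slice of `A` with free indices in `C` carries at least the average squared norm. -/
theorem exists_slice_sum_sq_ge {k d : ℕ} (hd : 1 ≤ d) (A : (Fin k → Fin d) → ℝ)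
    (C : Finset (Fin k)) :
    ∃ w : {n // n ∉ C} → Fin d, ∑ i, A i ^ 2 ≤ (d : ℝ) ^ (k - C.card) *
      ∑ v, A ((Equiv.piEquivPiSubtypeProd (· ∈ C) fun _ => Fin d).symm (v, w)) ^ 2 := by
  classical
  have : NeZero d := ⟨by omega⟩
  let e := Equiv.piEquivPiSubtypeProd (· ∈ C) fun _ => Fin d
  obtain ⟨w, -, hw⟩ := Finset.exists_max_image Finset.univ
    (fun w => ∑ v, A (e.symm (v, w)) ^ 2) Finset.univ_nonempty
  refine ⟨w, ?_⟩
  rw [← Equiv.sum_comp e.symm, Fintype.sum_prod_type_right]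
  refine (Finset.sum_le_card_nsmul _ _ _ hw).trans_eq ?_
  have hcard : Fintype.card {n // n ∉ C} = k - C.card := by
    simp [Fintype.card_subtype_compl]
  rw [nsmul_eq_mul, Finset.card_univ, Fintype.card_fun, hcard, Fintype.card_fin, Nat.cast_pow]

end TensorUnfolding

open TensorUnfolding in
/-- **Top-down inequality.** For an order-`k` tensor with all mode
dimensions equal to `d` and a partition `π` of `[k]`,
`d^{−(k − max_{B ∈ π} |B|)/2} ‖A‖_F ≤ ‖Unfold_π(A)‖_σ ≤ ‖A‖_F`. -/
theorem top_down_inequality {k : ℕ} (hk : 0 < k) (d : ℕ) (hd : 1 ≤ d)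
    (A : (Fin k → Fin d) → ℝ)
    (π : Finset (Finset (Fin k))) (hπ : IsPartition π) :
    (d : ℝ) ^ (-(((k - π.sup Finset.card : ℕ) : ℝ)) / 2) * frobNorm (fun _ => d) A ≤
      unfoldNorm (fun _ => d) A π ∧
    unfoldNorm (fun _ => d) A π ≤ frobNorm (fun _ => d) A := by
  have hbdd : ∀ r ∈ { r : ℝ | ∃ y : (B : Finset (Fin k)) → (B → Fin d) → ℝ,
      (∀ B ∈ π, ∑ v, (y B v) ^ 2 = 1) ∧
      r = ∑ i : Fin k → Fin d, A i * ∏ B ∈ π, y B fun j => i j.1 },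
      r ≤ frobNorm (fun _ => d) A := by
    rintro r ⟨y, hy, rfl⟩
    exact sum_mul_prod_le_frobNorm hπ A y hy
  refine ⟨?_, Real.sSup_le hbdd (Real.sqrt_nonneg _)⟩
  obtain ⟨B₀, hB₀, -⟩ := hπ.exists_mem ⟨0, hk⟩
  obtain ⟨C, hC, hmax⟩ := Finset.exists_mem_eq_sup π ⟨B₀, hB₀⟩ Finset.card
  obtain ⟨w, hw⟩ := exists_slice_sum_sq_ge hd A C
  refine le_trans ?_ (le_csSup ⟨_, hbdd⟩ (exists_unit_eq_sqrt_slice hd hπ A hC w))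
  have hd0 : (0 : ℝ) < d := by exact_mod_cast hd
  rw [hmax, neg_div, Real.rpow_neg hd0.le, inv_mul_le_iff₀ (Real.rpow_pos_of_pos hd0 _),
    Real.rpow_div_two_eq_sqrt _ hd0.le, Real.rpow_natCast]
  refine (Real.sqrt_le_sqrt hw).trans_eq ?_
  rw [Real.sqrt_mul (by positivity), Real.sqrt_eq_rpow (_ ^ _),
    ← Real.rpow_pow_comm hd0.le, ← Real.sqrt_eq_rpow]
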